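/- arXiv:2204.01936 — 3 statements merged into one kernel-verified Lean document; each statement's English description precedes it below -/
import Mathlib

section
/- There is an absolute constant c such that the following holds. Let G be a bipartite graph with N left nodes and left degree D. If G has ((2/3)D + 2)-expansion up to K, then G has dynamic matching up to K with load at most c·(log₂ N + 1). -/
/-!
Bipartite graphs are modelled by a neighborhood function `Nbr : L → Finset R`
on finite types `L` (left nodes) and `R` (right nodes).

The dynamic matching game with parameters `K` and `ℓ` (the load):
Requester and Matcher maintain a set `M` of edges, initially empty, and alternate
turns with Requester first.  At round `n`, Requester removes a set of edges from `M`
(so that afterwards `#M ≤ K - 1`) and selects a left node; Matcher replies, according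
to her strategy, by adding one edge of the graph incident on the selected node,
and afterwards every right node must be incident on at most `ℓ` edges of `M`.
A strategy is winning if against every legal play of Requester all these
conditions always hold.
-/

namespace DM

/-- A Requester move: a set of edges to remove from the matching, and the requested left node. -/
abbrev ReqMove (α β : Type) := Finset (α × β) × α

/-- A Matcher strategy: maps each finite history of Requester moves to the set of
edges Matcher adds (a valid reply adds exactly one edge incident on the request). -/
abbrev Strategy (α β : Type) := List (ReqMove α β) → Finset (α × β)

/-- A Requester move in the ε-rich game: a set of left nodes whose requests are retracted
(all their matched edges are removed together), and the requested left node. -/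
abbrev RReqMove (α : Type) := Finset α × α

/-- A Matcher strategy in the ε-rich game: maps each finite history of Requester moves
to the set of edges Matcher adds. -/
abbrev RStrategy (α β : Type) := List (RReqMove α) → Finset (α × β)

variable {L R R₁ R₂ : Type} [DecidableEq L] [DecidableEq R] [DecidableEq R₁] [DecidableEq R₂]

/-- The set of neighbors of a set `S` of left nodes. -/
def NbrSet (Nbr : L → Finset R) (S : Finset L) : Finset R := S.biUnion Nbr

/-- The graph has `e`-expansion up to `K`: every left set `S` with `#S ≤ K`
has at least `e · #S` neighbors. -/
def Expansion (Nbr : L → Finset R) (e : ℚ) (K : ℕ) : Prop :=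
  ∀ S : Finset L, S.card ≤ K → e * (S.card : ℚ) ≤ ((NbrSet Nbr S).card : ℚ)

/-- The `ℓ`-clone of a graph: `ℓ` copies of the right set, with `x` adjacent to `(y, i)`
iff `x` is adjacent to `y` in the original graph. -/
def clone (ℓ : ℕ) (Nbr : L → Finset R) : L → Finset (R × Fin ℓ) :=
  fun x => (Nbr x) ×ˢ (Finset.univ : Finset (Fin ℓ))

/-- The product of two graphs with the same left set: `x` is adjacent to `(y₁, y₂)` iff
`x` is adjacent to `y₁` in the first graph and to `y₂` in the second graph. -/
def prodGraph (Nbr₁ : L → Finset R₁) (Nbr₂ : L → Finset R₂) : L → Finset (R₁ × R₂) :=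
  fun x => (Nbr₁ x) ×ˢ (Nbr₂ x)

/-- The private neighbors of a left set `S`: right nodes with exactly one neighbor in `S`. -/
def privNbrs [Fintype R] (Nbr : L → Finset R) (S : Finset L) : Finset R :=
  Finset.univ.filter fun y => (S.filter fun x => y ∈ Nbr x).card = 1

/-- The history of Requester moves after round `n` (i.e. the moves of rounds `0, …, n`). -/
def histUpTo (req : ℕ → ReqMove L R) (n : ℕ) : List (ReqMove L R) :=
  List.ofFn fun i : Fin (n + 1) => req i.1

/-- The matching `M` after round `n` of play: at round `n`, Requester removes the edges
`(req n).1` and requests `(req n).2`, then Matcher adds the edge(s) given by her strategy. -/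
def matchingAfter (σ : Strategy L R) (req : ℕ → ReqMove L R) : ℕ → Finset (L × R)
  | 0 => ∅
  | n + 1 => σ (histUpTo req n) ∪ (matchingAfter σ req n \ (req n).1)

/-- Requester's move at round `n` is legal: after his removal, `#M ≤ K - 1`. -/
def RemLegal (σ : Strategy L R) (K : ℕ) (req : ℕ → ReqMove L R) (n : ℕ) : Prop :=
  (matchingAfter σ req n \ (req n).1).card < K

/-- Matcher's reply at round `n` is valid for load `ℓ`: she adds exactly one edge of the
graph, incident on the requested node, and afterwards every right node is incident on
at most `ℓ` edges of `M`. -/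
def ValidReply (Nbr : L → Finset R) (ℓ : ℕ) (σ : Strategy L R)
    (req : ℕ → ReqMove L R) (n : ℕ) : Prop :=
  (∃ y ∈ Nbr (req n).2, σ (histUpTo req n) = {((req n).2, y)}) ∧
  ∀ y : R, ((matchingAfter σ req (n + 1)).filter fun p => p.2 = y).card ≤ ℓ

/-- The graph has dynamic matching up to `K` with load `ℓ`: Matcher has a strategy that
replies validly to every legal play of Requester. -/
def DynamicMatching (Nbr : L → Finset R) (K ℓ : ℕ) : Prop :=
  ∃ σ : Strategy L R, ∀ req : ℕ → ReqMove L R, ∀ n : ℕ,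
    (∀ i ≤ n, RemLegal σ K req i) → ValidReply Nbr ℓ σ req n

/-- Incremental matching up to `K` with load `ℓ`: Requester never removes edges,
and the game lasts at most `K` rounds. -/
def IncrementalMatching (Nbr : L → Finset R) (K ℓ : ℕ) : Prop :=
  ∃ σ : Strategy L R, ∀ req : ℕ → ReqMove L R, (∀ i, (req i).1 = ∅) →
    ∀ n < K, ValidReply Nbr ℓ σ req n

/-- Matching with `T` rounds up to `K` with load `ℓ`: the dynamic matching game is
terminated after `T` rounds. -/
def RoundMatching (Nbr : L → Finset R) (T K ℓ : ℕ) : Prop :=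
  ∃ σ : Strategy L R, ∀ req : ℕ → ReqMove L R, ∀ n < T,
    (∀ i ≤ n, RemLegal σ K req i) → ValidReply Nbr ℓ σ req n

/-- The edge Matcher added at round `i` is removed by Requester during one of the
rounds `i + 1, …, i + T`. -/
def ExpiredAt (σ : Strategy L R) (T : ℕ) (req : ℕ → ReqMove L R) (i : ℕ) : Prop :=
  ∃ j, i < j ∧ j ≤ i + T ∧ ∀ e ∈ σ (histUpTo req i), e ∈ (req j).1

/-- Matching up to `K` with `T`-expiration and load `ℓ`: the dynamic matching game in
which Requester must remove the edge added at round `i` during one of the rounds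
`i + 1, …, i + T`. -/
def ExpiringMatching (Nbr : L → Finset R) (T K ℓ : ℕ) : Prop :=
  ∃ σ : Strategy L R, ∀ req : ℕ → ReqMove L R, ∀ n : ℕ,
    (∀ i ≤ n, RemLegal σ K req i) → (∀ i, i + T ≤ n → ExpiredAt σ T req i) →
    ValidReply Nbr ℓ σ req n

/-! ### The ε-rich matching game

In the ε-rich game on a graph with left degree `D`, when Requester requests a left node
`x`, Matcher adds to `M` in one round a set of at least `(1 - ε) · D` edges incident on
`x`; when Requester retracts a request, all its edges are removed together. -/

/-- The history of rich-game Requester moves after round `n`. -/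
def rhistUpTo (req : ℕ → RReqMove L) (n : ℕ) : List (RReqMove L) :=
  List.ofFn fun i : Fin (n + 1) => req i.1

/-- The matching `M` after round `n` of the rich game: at round `n`, Requester retracts
the requests of the left nodes in `(req n).1` (removing all their edges) and requests
`(req n).2`, then Matcher adds the set of edges given by her strategy. -/
def rmatchingAfter (σ : RStrategy L R) (req : ℕ → RReqMove L) : ℕ → Finset (L × R)
  | 0 => ∅
  | n + 1 => σ (rhistUpTo req n) ∪
      ((rmatchingAfter σ req n).filter fun p => p.1 ∉ (req n).1)

/-- Requester's rich-game move at round `n` is legal: after the retraction, at most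
`K - 1` requests remain matched. -/
def RRemLegal (σ : RStrategy L R) (K : ℕ) (req : ℕ → RReqMove L) (n : ℕ) : Prop :=
  ((((rmatchingAfter σ req n).filter fun p => p.1 ∉ (req n).1)).image Prod.fst).card < K

/-- Matcher's rich reply at round `n` is valid for richness `ε` (relative to left degree
`D`) and load `ℓ`: she adds at least `(1 - ε) · D` edges of the graph, all incident on
the requested node, and afterwards every right node is incident on at most `ℓ` edges. -/
def RValidReply (Nbr : L → Finset R) (D : ℕ) (ε : ℚ) (ℓ : ℕ) (σ : RStrategy L R)
    (req : ℕ → RReqMove L) (n : ℕ) : Prop :=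
  (∀ e ∈ σ (rhistUpTo req n), e.1 = (req n).2 ∧ e.2 ∈ Nbr e.1) ∧
  (1 - ε) * (D : ℚ) ≤ ((σ (rhistUpTo req n)).card : ℚ) ∧
  ∀ y : R, ((rmatchingAfter σ req (n + 1)).filter fun p => p.2 = y).card ≤ ℓ

/-- ε-rich matching up to `K` with load `ℓ` (richness relative to left degree `D`). -/
def RichMatching (Nbr : L → Finset R) (D : ℕ) (ε : ℚ) (K ℓ : ℕ) : Prop :=
  ∃ σ : RStrategy L R, ∀ req : ℕ → RReqMove L, ∀ n : ℕ,
    (∀ i ≤ n, RRemLegal σ K req i) → RValidReply Nbr D ε ℓ σ req n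

/-- Incremental ε-rich matching up to `K` with load `ℓ`: Requester never retracts,
and the game lasts at most `K` rounds. -/
def RichIncrementalMatching (Nbr : L → Finset R) (D : ℕ) (ε : ℚ) (K ℓ : ℕ) : Prop :=
  ∃ σ : RStrategy L R, ∀ req : ℕ → RReqMove L, (∀ i, (req i).1 = ∅) →
    ∀ n < K, RValidReply Nbr D ε ℓ σ req n

/-- ε-rich matching up to `K` with `T`-expiration and load `ℓ`: Requester must retract
the request made at round `i` during one of the rounds `i + 1, …, i + T`. -/
def RichExpiringMatching (Nbr : L → Finset R) (D : ℕ) (ε : ℚ) (T K ℓ : ℕ) : Prop :=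
  ∃ σ : RStrategy L R, ∀ req : ℕ → RReqMove L, ∀ n : ℕ,
    (∀ i ≤ n, RRemLegal σ K req i) →
    (∀ i, i + T ≤ n → ∃ j, i < j ∧ j ≤ i + T ∧ (req i).2 ∈ (req j).1) →
    RValidReply Nbr D ε ℓ σ req n

end DM

namespace DM

section FreeNeighbors

variable {L R : Type} [DecidableEq R]

/-- The neighbors of `X` that are not covered by the matching `M`. -/
def freeNbrs (Nbr : L → Finset R) (M : Finset (L × R)) (X : Finset L) : Finset R :=
  NbrSet Nbr X \ M.image Prod.snd

/-- Expansion by a factor `2` leaves more than `#X` free neighbors to sets of size between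
`K` and `2K`. -/
lemma card_lt_card_freeNbrs {Nbr : L → Finset R} {K : ℕ} {M : Finset (L × R)}
    (hexp : ∀ S : Finset L, S.card ≤ 2 * K → 2 * S.card ≤ (NbrSet Nbr S).card)
    (hM : M.card < K) {X : Finset L} (hX : K ≤ X.card) (hX' : X.card ≤ 2 * K) :
    X.card < (freeNbrs Nbr M X).card := by
  have h := hexp X hX'
  have h' := Finset.le_card_sdiff (M.image Prod.snd) (NbrSet Nbr X)
  have h'' : (M.image Prod.snd).card ≤ M.card := Finset.card_image_le
  unfold freeNbrs
  omega

/-- Expansion by `(2/3)D + 2` up to `K` forces expansion by a factor `2` up to `2K`. -/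
lemma two_mul_card_le_card_nbrSet {Nbr : L → Finset R} {D K : ℕ}
    (hD : ∀ x : L, (Nbr x).card = D) (hexp : Expansion Nbr ((2 / 3 : ℚ) * D + 2) K)
    (S : Finset L) (hS : S.card ≤ 2 * K) : 2 * S.card ≤ (NbrSet Nbr S).card := by
  rcases S.eq_empty_or_nonempty with rfl | ⟨x, hx⟩
  · simp
  have hpos : 0 < S.card := Finset.card_pos.mpr ⟨x, hx⟩
  have hD6 : (6 : ℚ) ≤ D := by
    have h := hexp {x} (by rw [Finset.card_singleton]; omega)
    simp only [NbrSet, Finset.singleton_biUnion, hD, Finset.card_singleton] at h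
    push_cast at h
    linarith
  obtain ⟨T, hTS, hT⟩ := Finset.exists_subset_card_eq (min_le_left S.card K)
  have h := hexp T (hT ▸ min_le_right _ _)
  have hle : (NbrSet Nbr T).card ≤ (NbrSet Nbr S).card :=
    Finset.card_le_card (Finset.biUnion_subset_biUnion_of_subset_left _ hTS)
  have h4 : (4 : ℚ) * T.card ≤ (NbrSet Nbr T).card := by
    refine le_trans ?_ h
    gcongr
    linarith
  have h4' : 4 * T.card ≤ (NbrSet Nbr T).card := by exact_mod_cast h4
  omega

variable [DecidableEq L]

/-- The invariant kept by Matcher: `M` is a set of edges of the graph with load `1`, and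
every set of at most `K` unmatched left nodes satisfies Hall's condition with respect to
the uncovered right nodes. -/
structure HallReserve (Nbr : L → Finset R) (K : ℕ) (M : Finset (L × R)) : Prop where
  edge : ∀ p ∈ M, p.2 ∈ Nbr p.1
  inj : Set.InjOn Prod.snd (M : Set (L × R))
  hall : ∀ X : Finset L, Disjoint X (M.image Prod.fst) → X.card ≤ K →
    X.card ≤ (freeNbrs Nbr M X).card

lemma freeNbrs_union (Nbr : L → Finset R) (M : Finset (L × R)) (X Y : Finset L) :
    freeNbrs Nbr M (X ∪ Y) = freeNbrs Nbr M X ∪ freeNbrs Nbr M Y := by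
  simp only [freeNbrs, NbrSet, Finset.union_biUnion, Finset.union_sdiff_distrib]

lemma freeNbrs_inter_subset (Nbr : L → Finset R) (M : Finset (L × R)) (X Y : Finset L) :
    freeNbrs Nbr M (X ∩ Y) ⊆ freeNbrs Nbr M X ∩ freeNbrs Nbr M Y := by
  intro y
  simp only [freeNbrs, NbrSet, Finset.mem_inter, Finset.mem_sdiff, Finset.mem_biUnion]
  rintro ⟨⟨x, ⟨hx, hx'⟩, hy⟩, h⟩
  exact ⟨⟨⟨x, hx, hy⟩, h⟩, ⟨x, hx', hy⟩, h⟩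

lemma card_freeNbrs_submodular (Nbr : L → Finset R) (M : Finset (L × R)) (X Y : Finset L) :
    (freeNbrs Nbr M (X ∪ Y)).card + (freeNbrs Nbr M (X ∩ Y)).card ≤
      (freeNbrs Nbr M X).card + (freeNbrs Nbr M Y).card := by
  rw [freeNbrs_union,
    ← Finset.card_union_add_card_inter (freeNbrs Nbr M X) (freeNbrs Nbr M Y)]
  exact Nat.add_le_add_left (Finset.card_le_card (freeNbrs_inter_subset Nbr M X Y)) _

variable {Nbr : L → Finset R} {K : ℕ} {M : Finset (L × R)}

lemma HallReserve.empty
    (hexp : ∀ S : Finset L, S.card ≤ 2 * K → 2 * S.card ≤ (NbrSet Nbr S).card) :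
    HallReserve Nbr K ∅ where
  edge := by simp
  inj := by simp
  hall X _ hX := by
    have := hexp X (by omega)
    simp only [freeNbrs, Finset.image_empty, Finset.sdiff_empty]
    omega

/-- Removing edges keeps the invariant. -/
lemma HallReserve.mono (h : HallReserve Nbr K M) {M' : Finset (L × R)} (hs : M' ⊆ M) :
    HallReserve Nbr K M' where
  edge p hp := h.edge p (hs hp)
  inj := h.inj.mono (by exact_mod_cast hs)
  hall X hX hXK := by
    set X₀ := X \ M.image Prod.fst with hX₀
    set P := M.filter (fun p => p.1 ∈ X) with hP
    have hPM : P ⊆ M := Finset.filter_subset _ _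
    have h₀ := h.hall X₀ Finset.sdiff_disjoint
      ((Finset.card_le_card Finset.sdiff_subset).trans hXK)
    have hXsub : X ⊆ X₀ ∪ P.image Prod.fst := by
      intro x hx
      simp only [hX₀, hP, Finset.mem_union, Finset.mem_sdiff, Finset.mem_image,
        Finset.mem_filter]
      by_cases hm : ∃ p ∈ M, p.1 = x
      · obtain ⟨p, hp, rfl⟩ := hm
        exact Or.inr ⟨p, ⟨hp, hx⟩, rfl⟩
      · exact Or.inl ⟨hx, hm⟩
    have hXcard : X.card ≤ X₀.card + (P.image Prod.fst).card :=
      (Finset.card_le_card hXsub).trans (Finset.card_union_le _ _)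
    have hPfst : (P.image Prod.fst).card ≤ P.card := Finset.card_image_le
    have hPsnd : (P.image Prod.snd).card = P.card :=
      Finset.card_image_of_injOn (h.inj.mono (by exact_mod_cast hPM))
    have hdisj : Disjoint (freeNbrs Nbr M X₀) (P.image Prod.snd) :=
      Finset.sdiff_disjoint.mono_right (Finset.image_subset_image hPM)
    have hsub : freeNbrs Nbr M X₀ ∪ P.image Prod.snd ⊆ freeNbrs Nbr M' X := by
      apply Finset.union_subset
      · exact Finset.sdiff_subset_sdiff
          (Finset.biUnion_subset_biUnion_of_subset_left _ Finset.sdiff_subset)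
          (Finset.image_subset_image hs)
      · intro y hy
        obtain ⟨p, hp, rfl⟩ := Finset.mem_image.mp hy
        obtain ⟨hpM, hpX⟩ := Finset.mem_filter.mp hp
        refine Finset.mem_sdiff.mpr
          ⟨Finset.mem_biUnion.mpr ⟨p.1, hpX, h.edge p hpM⟩, fun hcov => ?_⟩
        obtain ⟨q, hq, hqp⟩ := Finset.mem_image.mp hcov
        obtain rfl : q = p := h.inj (hs hq) hpM hqp
        exact Finset.disjoint_left.mp hX hpX (Finset.mem_image_of_mem _ hq)
    have hcard := Finset.card_le_card hsub
    rw [Finset.card_union_of_disjoint hdisj] at hcard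
    omega

/-- If every free neighbor in `T` is blocked by a critical set, then `T` is covered by the free
neighbors of a single critical set. -/
lemma HallReserve.exists_critical_cover (h : HallReserve Nbr K M) (hM : M.card < K)
    (hexp : ∀ S : Finset L, S.card ≤ 2 * K → 2 * S.card ≤ (NbrSet Nbr S).card)
    {U : Finset L} (hU : M.image Prod.fst ⊆ U) (T : Finset R)
    (hT : ∀ y ∈ T, ∃ X : Finset L, Disjoint X U ∧ X.card ≤ K ∧
      y ∈ freeNbrs Nbr M X ∧ (freeNbrs Nbr M X).card ≤ X.card) :
    ∃ X : Finset L, Disjoint X U ∧ X.card ≤ K ∧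
      T ⊆ freeNbrs Nbr M X ∧ (freeNbrs Nbr M X).card ≤ X.card := by
  induction T using Finset.induction_on with
  | empty => exact ⟨∅, by simp, by simp, by simp, by simp [freeNbrs, NbrSet]⟩
  | insert y T _ ih =>
    obtain ⟨X, hXU, hXK, hTX, hX⟩ := ih fun z hz => hT z (Finset.mem_insert_of_mem hz)
    obtain ⟨Y, hYU, hYK, hyY, hY⟩ := hT y (Finset.mem_insert_self _ _)
    have hinter := h.hall (X ∩ Y)
      (hXU.mono Finset.inter_subset_left hU)
      ((Finset.card_le_card Finset.inter_subset_left).trans hXK)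
    have hsub := card_freeNbrs_submodular Nbr M X Y
    have hcard := Finset.card_union_add_card_inter X Y
    have hcrit : (freeNbrs Nbr M (X ∪ Y)).card ≤ (X ∪ Y).card := by omega
    refine ⟨X ∪ Y, Finset.disjoint_union_left.mpr ⟨hXU, hYU⟩, ?_, ?_, hcrit⟩
    · by_contra hlt
      have := card_lt_card_freeNbrs hexp hM (X := X ∪ Y) (by omega) (by omega)
      omega
    · rw [freeNbrs_union]
      exact Finset.insert_subset (Finset.mem_union_right _ hyY)
        (hTX.trans Finset.subset_union_left)

/-- Matcher can serve any request while keeping the invariant. -/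
lemma HallReserve.exists_insert (h : HallReserve Nbr K M) (hM : M.card < K)
    (hexp : ∀ S : Finset L, S.card ≤ 2 * K → 2 * S.card ≤ (NbrSet Nbr S).card) (x : L) :
    ∃ y ∈ Nbr x, HallReserve Nbr K (insert (x, y) M) := by
  by_cases hx : x ∈ M.image Prod.fst
  · obtain ⟨p, hp, rfl⟩ := Finset.mem_image.mp hx
    exact ⟨p.2, h.edge p hp, by rwa [Finset.insert_eq_of_mem hp]⟩
  by_contra! hcon
  set U := insert x (M.image Prod.fst) with hUdef
  have hblock : ∀ y ∈ freeNbrs Nbr M {x}, ∃ X : Finset L, Disjoint X U ∧ X.card ≤ K ∧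
      y ∈ freeNbrs Nbr M X ∧ (freeNbrs Nbr M X).card ≤ X.card := by
    intro y hy
    obtain ⟨hyx, hyM⟩ := Finset.mem_sdiff.mp hy
    have hyx : y ∈ Nbr x := by simpa [NbrSet] using hyx
    by_contra! hno
    refine hcon y hyx ⟨?_, ?_, fun X hXU hXK => ?_⟩
    · intro p hp
      rcases Finset.mem_insert.mp hp with rfl | hp
      exacts [hyx, h.edge p hp]
    · rw [Finset.coe_insert, Set.injOn_insert]
      · exact ⟨h.inj, by simpa using hyM⟩
      · exact fun hmem => hyM (Finset.mem_image_of_mem Prod.snd (Finset.mem_coe.mp hmem))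
    · rw [Finset.image_insert] at hXU
      have hfree : freeNbrs Nbr (insert (x, y) M) X = (freeNbrs Nbr M X).erase y := by
        simp only [freeNbrs, Finset.image_insert, Finset.sdiff_insert]
      rw [hfree]
      by_cases hyX : y ∈ freeNbrs Nbr M X
      · have := hno X hXU hXK hyX
        rw [Finset.card_erase_of_mem hyX]
        omega
      · rw [Finset.erase_eq_of_notMem hyX]
        exact h.hall X (hXU.mono_right (Finset.subset_insert _ _)) hXK
  obtain ⟨X, hXU, hXK, hcover, hX⟩ :=
    h.exists_critical_cover hM hexp (Finset.subset_insert x _) _ hblock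
  obtain ⟨hxX, hXM⟩ := Finset.disjoint_insert_right.mp hXU
  have hfree : freeNbrs Nbr M (insert x X) = freeNbrs Nbr M X := by
    rw [Finset.insert_eq, freeNbrs_union, Finset.union_eq_right.mpr hcover]
  have hcard := Finset.card_insert_of_notMem hxX
  by_cases hlt : X.card < K
  · have := h.hall (insert x X) (Finset.disjoint_insert_left.mpr ⟨hx, hXM⟩) (by omega)
    rw [hfree] at this
    omega
  · have := card_lt_card_freeNbrs hexp hM (X := insert x X) (by omega) (by omega)
    rw [hfree] at this
    omega

end FreeNeighbors

section Play

variable {L R : Type}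

lemma histUpTo_eq_append (req : ℕ → ReqMove L R) (n : ℕ) :
    histUpTo req n = (List.ofFn fun i : Fin n => req i.1) ++ [req n] := by
  rw [histUpTo, List.ofFn_succ', List.concat_eq_append]
  rfl

variable [DecidableEq L] [DecidableEq R]

/-- The matching reached after a history of Requester moves when Matcher answers the request
of `x` at matching `M` by the edges `reply M x`. -/
def replayMatching (reply : Finset (L × R) → L → Finset (L × R)) (h : List (ReqMove L R)) :
    Finset (L × R) :=
  h.foldl (fun M m => reply (M \ m.1) m.2 ∪ (M \ m.1)) ∅

/-- The strategy that answers according to the current matching and request only. -/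
def positionalStrategy (reply : Finset (L × R) → L → Finset (L × R)) : Strategy L R := fun h =>
  match h.getLast? with
  | none => ∅
  | some m => reply (replayMatching reply h.dropLast \ m.1) m.2

lemma matchingAfter_positionalStrategy_eq_replay
    (reply : Finset (L × R) → L → Finset (L × R)) (req : ℕ → ReqMove L R) (n : ℕ) :
    matchingAfter (positionalStrategy reply) req n =
      replayMatching reply (List.ofFn fun i : Fin n => req i.1) := by
  induction n with
  | zero => simp [matchingAfter, replayMatching]
  | succ n ih =>
    have hhist := histUpTo_eq_append req n
    change _ = replayMatching reply (histUpTo req n)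
    rw [matchingAfter, ih, hhist]
    simp [positionalStrategy, replayMatching]

lemma positionalStrategy_histUpTo
    (reply : Finset (L × R) → L → Finset (L × R)) (req : ℕ → ReqMove L R) (n : ℕ) :
    positionalStrategy reply (histUpTo req n) =
      reply (matchingAfter (positionalStrategy reply) req n \ (req n).1) (req n).2 := by
  rw [matchingAfter_positionalStrategy_eq_replay, histUpTo_eq_append]
  simp [positionalStrategy]

/-- Expansion by a factor `2` up to `2K` yields dynamic matching up to `K` (with load `1`). -/
theorem dynamicMatching_one_of_expansion {Nbr : L → Finset R} {K : ℕ}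
    (hexp : ∀ S : Finset L, S.card ≤ 2 * K → 2 * S.card ≤ (NbrSet Nbr S).card) :
    DynamicMatching Nbr K 1 := by
  classical
  have hreply : ∀ (M : Finset (L × R)) (x : L), ∃ E : Finset (L × R),
      HallReserve Nbr K M → M.card < K →
        (∃ y ∈ Nbr x, E = {(x, y)}) ∧ HallReserve Nbr K (E ∪ M) := by
    intro M x
    by_cases h : HallReserve Nbr K M ∧ M.card < K
    · obtain ⟨y, hy, hres⟩ := h.1.exists_insert h.2 hexp x
      exact ⟨{(x, y)}, fun _ _ => ⟨⟨y, hy, rfl⟩, by rwa [← Finset.insert_eq]⟩⟩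
    · exact ⟨∅, fun h₁ h₂ => absurd ⟨h₁, h₂⟩ h⟩
  choose reply hreply using hreply
  refine ⟨positionalStrategy reply, fun req n hleg => ?_⟩
  have hres : ∀ m ≤ n + 1,
      HallReserve Nbr K (matchingAfter (positionalStrategy reply) req m) := by
    intro m hm
    induction m with
    | zero => exact HallReserve.empty hexp
    | succ m ih =>
      rw [matchingAfter, positionalStrategy_histUpTo]
      exact (hreply _ _ ((ih (by omega)).mono Finset.sdiff_subset) (hleg m (by omega))).2
  refine ⟨?_, fun y => ?_⟩
  · rw [positionalStrategy_histUpTo]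
    exact (hreply _ _ ((hres n (by omega)).mono Finset.sdiff_subset) (hleg n le_rfl)).1
  · refine Finset.card_le_one.mpr fun p hp q hq => ?_
    obtain ⟨hpM, hpy⟩ := Finset.mem_filter.mp hp
    obtain ⟨hqM, hqy⟩ := Finset.mem_filter.mp hq
    exact (hres (n + 1) le_rfl).inj hpM hqM (hpy.trans hqy.symm)

lemma DynamicMatching.mono_load {Nbr : L → Finset R} {K ℓ ℓ' : ℕ} (hℓ : ℓ ≤ ℓ')
    (h : DynamicMatching Nbr K ℓ) : DynamicMatching Nbr K ℓ' := by
  obtain ⟨σ, hσ⟩ := h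
  exact ⟨σ, fun req n hleg =>
    ⟨(hσ req n hleg).1, fun y => ((hσ req n hleg).2 y).trans hℓ⟩⟩

end Play

end DM

open DM
/-- There is an absolute constant `c` such that: if a bipartite graph with
`N` left nodes and left degree `D` has `((2/3)·D + 2)`-expansion up to `K`, then it has
dynamic matching up to `K` with load at most `c · (log₂ N + 1)`. -/
theorem stmt0 :
    ∃ c : ℕ, ∀ (L R : Type) [Fintype L] [Fintype R] [DecidableEq L] [DecidableEq R]
      (Nbr : L → Finset R) (D K : ℕ),
      (∀ x : L, (Nbr x).card = D) →
      Expansion Nbr ((2 / 3 : ℚ) * D + 2) K →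
      DynamicMatching Nbr K (c * (Nat.log 2 (Fintype.card L) + 1)) := by
  refine ⟨1, fun L R _ _ _ _ Nbr D K hD hexp => ?_⟩
  exact (dynamicMatching_one_of_expansion (two_mul_card_le_card_nbrSet hD hexp)).mono_load
    (by omega)
end

section
/- If a bipartite graph G has 1-expansion up to K, then the (1 + ⌈log₂ K⌉)-clone of G has incremental matching up to K (with load 1). -/
namespace DM

variable {L R : Type} [DecidableEq L] [DecidableEq R]

/-- If a property `P` of edge sets bounds the load by `ℓ`, holds for the empty set, and can be
maintained by adding a suitable edge at any requested node, then Matcher wins the incremental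
game. -/
theorem IncrementalMatching.of_invariant (Nbr : L → Finset R) (K ℓ : ℕ)
    (P : Finset (L × R) → Prop) (empty : P ∅)
    (step : ∀ M x, P M → M.card < K → ∃ y ∈ Nbr x, P (insert (x, y) M))
    (load : ∀ M, P M → ∀ y : R, (M.filter fun p => p.2 = y).card ≤ ℓ) :
    IncrementalMatching Nbr K ℓ := by
  have total : ∀ (M : Finset (L × R)) (x : L), ∃ E : Finset (L × R),
      P M → M.card < K → ∃ y ∈ Nbr x, E = {(x, y)} ∧ P (E ∪ M) := by
    intro M x
    by_cases h : P M ∧ M.card < K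
    · obtain ⟨y, hy, hP⟩ := step M x h.1 h.2
      exact ⟨{(x, y)}, fun _ _ => ⟨y, hy, rfl, by rwa [← Finset.insert_eq]⟩⟩
    · exact ⟨∅, fun h₁ h₂ => absurd ⟨h₁, h₂⟩ h⟩
  choose reply reply_spec using total
  let state : List (ReqMove L R) → Finset (L × R) :=
    List.foldr (fun m M => reply M m.2 ∪ M) ∅
  let σ : Strategy L R := fun hist =>
    match hist.reverse with
    | [] => ∅
    | m :: past => reply (state past) m.2
  refine ⟨σ, fun req hreq => ?_⟩
  have reverse_succ : ∀ n, (histUpTo req n).reverse =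
      req n :: (List.ofFn fun i : Fin n => req i.1).reverse := by
    intro n
    rw [histUpTo, List.ofFn_succ_last, List.reverse_append]
    rfl
  have σ_eq : ∀ n, σ (histUpTo req n) =
      reply (state (List.ofFn fun i : Fin n => req i.1).reverse) (req n).2 := by
    intro n
    simp only [σ, reverse_succ]
  have matching_eq : ∀ n, matchingAfter σ req n =
      state (List.ofFn fun i : Fin n => req i.1).reverse := by
    intro n
    induction n with
    | zero => simp [matchingAfter, state]
    | succ n ih =>
      have hs := reverse_succ n
      rw [histUpTo] at hs
      rw [matchingAfter, σ_eq, hreq, Finset.sdiff_empty, ih, hs]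
      rfl
  have succ_eq : ∀ n, matchingAfter σ req (n + 1) =
      reply (matchingAfter σ req n) (req n).2 ∪ matchingAfter σ req n := by
    intro n
    rw [matchingAfter, σ_eq, hreq, Finset.sdiff_empty, matching_eq]
  have inv : ∀ n ≤ K, P (matchingAfter σ req n) ∧ (matchingAfter σ req n).card ≤ n := by
    intro n
    induction n with
    | zero => exact fun _ => ⟨empty, by simp [matchingAfter]⟩
    | succ n ih =>
      intro hn
      obtain ⟨hP, hcard⟩ := ih (by omega)
      obtain ⟨y, -, hE, hP'⟩ := reply_spec _ (req n).2 hP (by omega)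
      rw [succ_eq]
      refine ⟨hP', (Finset.card_union_le _ _).trans ?_⟩
      rw [hE, Finset.card_singleton]
      omega
  intro n hn
  obtain ⟨hP, hcard⟩ := inv n hn.le
  obtain ⟨y, hy, hE, -⟩ := reply_spec _ (req n).2 hP (by omega)
  refine ⟨⟨y, hy, ?_⟩, load _ (inv (n + 1) hn).1⟩
  rw [σ_eq, ← matching_eq, hE]

/-- A matching in the clone of a graph that can arise by matching every left node
in the first level that has a free neighbor. -/
structure IsFirstFit {ℓ : ℕ} (Nbr : L → Finset R) (M : Finset (L × (R × Fin ℓ))) : Prop where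
  adj : ∀ p ∈ M, p.2.1 ∈ Nbr p.1
  left_inj : ∀ p ∈ M, ∀ q ∈ M, p.1 = q.1 → p = q
  right_inj : ∀ p ∈ M, ∀ q ∈ M, p.2 = q.2 → p = q
  saturated : ∀ p ∈ M, ∀ j < p.2.2, ∀ y ∈ Nbr p.1, ∃ q ∈ M, q.2 = (y, j)

namespace IsFirstFit

variable {ℓ : ℕ} {Nbr : L → Finset R} {M : Finset (L × (R × Fin ℓ))} {K : ℕ}

/-- If all clones of neighbors of an unmatched node `x` are used, the number of left nodes that
compete for a level, counting `x`, at least halves from each level to the next. -/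
theorem two_mul_card_succ_le (hM : IsFirstFit Nbr M) (hexp : Expansion Nbr 1 K)
    (hcard : M.card < K) {x : L} (hx : ∀ p ∈ M, p.1 ≠ x)
    (hfull : ∀ y ∈ Nbr x, ∀ j, ∃ q ∈ M, q.2 = (y, j)) {i : ℕ} (hi : i < ℓ) :
    2 * ((M.filter fun p => i + 1 ≤ (p.2.2 : ℕ)).card + 1) ≤
      (M.filter fun p => i ≤ (p.2.2 : ℕ)).card + 1 := by
  set above := M.filter fun p => i + 1 ≤ (p.2.2 : ℕ) with habove
  set level := M.filter fun p => (p.2.2 : ℕ) = i with hlevel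
  have hsplit : (M.filter fun p => i ≤ (p.2.2 : ℕ)).card = above.card + level.card := by
    rw [habove, hlevel, ← Finset.card_union_of_disjoint, ← Finset.filter_or]
    · congr 1
      ext p
      simp only [Finset.mem_filter]
      exact and_congr_right fun _ => by omega
    · exact Finset.disjoint_filter.2 fun p _ h h' => by omega
  have hA : (insert x (above.image Prod.fst)).card = above.card + 1 := by
    rw [Finset.card_insert_of_notMem, Finset.card_image_of_injOn]
    · intro p hp q hq h
      exact hM.left_inj p (Finset.mem_filter.1 hp).1 q (Finset.mem_filter.1 hq).1 h
    · rw [Finset.mem_image]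
      rintro ⟨p, hp, rfl⟩
      exact hx p (Finset.mem_filter.1 hp).1 rfl
  have hle : above.card ≤ M.card := Finset.card_filter_le _ _
  have hE := hexp (insert x (above.image Prod.fst)) (by omega)
  rw [one_mul, Nat.cast_le, hA] at hE
  have hsub : NbrSet Nbr (insert x (above.image Prod.fst)) ⊆ level.image fun p => p.2.1 := by
    intro y hy
    obtain ⟨z, hz, hyz⟩ := Finset.mem_biUnion.1 hy
    have : ∃ q ∈ M, q.2 = (y, (⟨i, hi⟩ : Fin ℓ)) := by
      rcases Finset.mem_insert.1 hz with rfl | hz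
      · exact hfull y hyz _
      · obtain ⟨p, hp, rfl⟩ := Finset.mem_image.1 hz
        rw [habove, Finset.mem_filter] at hp
        exact hM.saturated p hp.1 ⟨i, hi⟩ (Fin.lt_def.2 hp.2) y hyz
    obtain ⟨q, hq, hqy⟩ := this
    exact Finset.mem_image.2 ⟨q, Finset.mem_filter.2 ⟨hq, by rw [hqy]⟩, by rw [hqy]⟩
  have hN := (Finset.card_le_card hsub).trans Finset.card_image_le
  omega

theorem exists_free (hM : IsFirstFit Nbr M) (hexp : Expansion Nbr 1 K) (hℓ : K < 2 ^ ℓ)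
    (hcard : M.card < K) {x : L} (hx : ∀ p ∈ M, p.1 ≠ x) :
    ∃ j : Fin ℓ, ∃ y ∈ Nbr x, ∀ q ∈ M, q.2 ≠ (y, j) := by
  by_contra! hfull
  have hpow : ∀ i ≤ ℓ, 2 ^ i * ((M.filter fun p => i ≤ (p.2.2 : ℕ)).card + 1) ≤ M.card + 1 := by
    intro i
    induction i with
    | zero => simp
    | succ i ih =>
      intro hi
      have h := hM.two_mul_card_succ_le hexp hcard hx (fun y hy j => hfull j y hy) hi
      calc _ = 2 ^ i * (2 * ((M.filter fun p => i + 1 ≤ (p.2.2 : ℕ)).card + 1)) := by ring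
        _ ≤ _ := (Nat.mul_le_mul_left _ h).trans (ih (by omega))
  have h := (Nat.le_mul_of_pos_right (2 ^ ℓ) (Nat.succ_pos _)).trans (hpow ℓ le_rfl)
  omega

theorem exists_insert (hM : IsFirstFit Nbr M) (hexp : Expansion Nbr 1 K) (hℓ : K < 2 ^ ℓ)
    (hcard : M.card < K) (x : L) :
    ∃ y ∈ clone ℓ Nbr x, IsFirstFit Nbr (insert (x, y) M) := by
  by_cases hx : ∃ p ∈ M, p.1 = x
  · obtain ⟨p, hp, rfl⟩ := hx
    refine ⟨p.2, ?_, ?_⟩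
    · simpa [clone] using hM.adj p hp
    · rwa [Finset.insert_eq_of_mem hp]
  push Not at hx
  obtain ⟨j, ⟨y, hy, hfree⟩, hmin⟩ := WellFounded.has_min (wellFounded_lt (α := Fin ℓ))
    {j | ∃ y ∈ Nbr x, ∀ q ∈ M, q.2 ≠ (y, j)} (hM.exists_free hexp hℓ hcard hx)
  refine ⟨(y, j), by simpa [clone] using hy, ?_, ?_, ?_, ?_⟩
  · exact Finset.forall_mem_insert _ _ _ |>.2 ⟨hy, hM.adj⟩
  · intro p hp q hq h
    rcases Finset.mem_insert.1 hp with rfl | hp' <;> rcases Finset.mem_insert.1 hq with rfl | hq'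
    · rfl
    · exact absurd h.symm (hx q hq')
    · exact absurd h (hx p hp')
    · exact hM.left_inj p hp' q hq' h
  · intro p hp q hq h
    rcases Finset.mem_insert.1 hp with rfl | hp' <;> rcases Finset.mem_insert.1 hq with rfl | hq'
    · rfl
    · exact absurd h.symm (hfree q hq')
    · exact absurd h (hfree p hp')
    · exact hM.right_inj p hp' q hq' h
  · intro p hp i hi z hz
    suffices ∃ q ∈ M, q.2 = (z, i) by
      obtain ⟨q, hq, h⟩ := this
      exact ⟨q, Finset.mem_insert_of_mem hq, h⟩
    rcases Finset.mem_insert.1 hp with rfl | hp'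
    · by_contra! h
      exact hmin i ⟨z, hz, h⟩ hi
    · exact hM.saturated p hp' i hi z hz

end IsFirstFit

end DM

open DM
/-- If a bipartite graph has 1-expansion up to `K`, then its
`(1 + ⌈log₂ K⌉)`-clone has incremental matching up to `K` with load 1. -/
theorem stmt4 (L R : Type) [Fintype L] [Fintype R] [DecidableEq L] [DecidableEq R]
    (Nbr : L → Finset R) (K : ℕ)
    (hexp : Expansion Nbr 1 K) :
    IncrementalMatching (clone (1 + Nat.clog 2 K) Nbr) K 1 := by
  rcases Nat.eq_zero_or_pos K with rfl | hK
  · exact ⟨fun _ => ∅, fun _ _ n hn => absurd hn n.not_lt_zero⟩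
  have hℓ : K < 2 ^ (1 + Nat.clog 2 K) := by
    have := Nat.le_pow_clog one_lt_two K
    rw [pow_add]
    omega
  refine IncrementalMatching.of_invariant _ K 1 (IsFirstFit Nbr)
    ⟨by simp, by simp, by simp, by simp⟩ (fun M x hM hcard => hM.exists_insert hexp hℓ hcard x) ?_
  intro M hM y
  refine Finset.card_le_one.2 fun p hp q hq => ?_
  rw [Finset.mem_filter] at hp hq
  exact hM.right_inj p hp.1 q hq.1 (hp.2.trans hq.2.symm)
end

section
/- Let K ≥ 1 and let T = K·2^j for some integer j ≥ 0. If a bipartite graph G has 3-expansion up to K, then the (1 + ⌊log₂ T⌋)-clone of G has matching with T rounds (with load 1). -/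
open DM

namespace DM

section LevelStrategy

variable {L R : Type} {ℓ : ℕ}

/-- The bookkeeping invariant of one level during a phase without release of held edges:
`O` is the set of held edges of the level, `c` their initial number, `A` the set of left nodes
whose requests reached the level, and `F` the set of those that could not be answered there. -/
structure LevelInv (Nbr : L → Finset R) (O : Finset (L × (R × Fin ℓ))) (A F : Finset L)
    (c : ℕ) : Prop where
  held : ∀ x ∈ A, x ∈ F ∨ ∃ e ∈ O, e.1 = x
  blocked : ∀ x ∈ F, ∀ y ∈ Nbr x, ∃ e ∈ O, e.2.1 = y
  card_le : O.card + F.card ≤ c + A.card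

theorem LevelInv.start (Nbr : L → Finset R) {O : Finset (L × (R × Fin ℓ))} {c : ℕ}
    (h : O.card ≤ c) : LevelInv Nbr O ∅ ∅ c :=
  ⟨by simp, by simp, by simpa using h⟩

variable [DecidableEq R]

theorem LevelInv.three_mul_card_le {Nbr : L → Finset R} {O : Finset (L × (R × Fin ℓ))}
    {A F : Finset L} {c K : ℕ} (h : LevelInv Nbr O A F c) (hexp : Expansion Nbr 3 K)
    {S : Finset L} (hS : S ⊆ F) (hSK : S.card ≤ K) : 3 * S.card ≤ O.card := by
  have h1 : 3 * S.card ≤ (NbrSet Nbr S).card := by exact_mod_cast hexp S hSK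
  have h2 : NbrSet Nbr S ⊆ O.image fun e => e.2.1 := by
    intro y hy
    obtain ⟨x, hx, hxy⟩ := Finset.mem_biUnion.mp hy
    exact Finset.mem_image.mpr (h.blocked x (hS hx) y hxy)
  exact h1.trans ((Finset.card_le_card h2).trans Finset.card_image_le)

theorem LevelInv.card_le_of_card_le_two_mul {Nbr : L → Finset R}
    {O : Finset (L × (R × Fin ℓ))} {A F : Finset L} {c K : ℕ} (h : LevelInv Nbr O A F c)
    (hexp : Expansion Nbr 3 K) (hc : c ≤ K) (hA : A.card ≤ 2 * K) : F.card ≤ K := by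
  by_contra! hF
  obtain ⟨S, hS, hSK⟩ := Finset.exists_subset_card_eq hF.le
  have h1 := h.three_mul_card_le hexp hS hSK.le
  have h2 := h.card_le
  omega

theorem LevelInv.two_mul_card_le {Nbr : L → Finset R}
    {O : Finset (L × (R × Fin ℓ))} {A F : Finset L} {K : ℕ} (h : LevelInv Nbr O A F 0)
    (hexp : Expansion Nbr 3 K) (hA : A.card ≤ K) : 2 * F.card ≤ A.card := by
  have h2 := h.card_le
  have h1 := h.three_mul_card_le hexp subset_rfl (by omega)
  omega

variable [DecidableEq L]

/-- The edges of the clone that may answer a request for `x` while the edges in `H` are held: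
held edges at `x`, and edges at `x` whose right node is not held. The `Fin ℓ` component of a
right node of the clone is called its level. -/
def availEdges (Nbr : L → Finset R) (H : Finset (L × (R × Fin ℓ))) (x : L) :
    Finset (L × (R × Fin ℓ)) :=
  H.filter (fun e => e.1 = x) ∪
    ((clone ℓ Nbr x).filter fun z => ∀ e ∈ H, e.2 ≠ z).image fun z => (x, z)

theorem mem_availEdges {Nbr : L → Finset R} {H : Finset (L × (R × Fin ℓ))} {x : L}
    {e : L × (R × Fin ℓ)} :
    e ∈ availEdges Nbr H x ↔
      e.1 = x ∧ (e ∈ H ∨ e.2.1 ∈ Nbr x ∧ ∀ e' ∈ H, e'.2 ≠ e.2) := by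
  obtain ⟨a, y, k⟩ := e
  simp only [availEdges, clone, Finset.mem_union, Finset.mem_filter, Finset.mem_image,
    Finset.mem_product, Finset.mem_univ, and_true, Prod.mk.injEq]
  constructor
  · rintro (⟨h, rfl⟩ | ⟨z, ⟨hz, hz'⟩, rfl, rfl⟩)
    · exact ⟨rfl, Or.inl h⟩
    · exact ⟨rfl, Or.inr ⟨hz, hz'⟩⟩
  · rintro ⟨rfl, h | ⟨h, h'⟩⟩
    · exact Or.inl ⟨h, rfl⟩
    · exact Or.inr ⟨(y, k), ⟨h, h'⟩, rfl, rfl⟩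

/-- Ranks available edges by level, preferring held edges within a level. -/
def edgeRank (H : Finset (L × (R × Fin ℓ))) (e : L × (R × Fin ℓ)) : ℕ :=
  2 * e.2.2.val + if e ∈ H then 0 else 1

open Classical in
/-- The reply to a request for `x`: an available edge of minimal rank, if there is one. -/
noncomputable def levelReply (Nbr : L → Finset R) (H : Finset (L × (R × Fin ℓ))) (x : L) :
    Finset (L × (R × Fin ℓ)) :=
  if h : (availEdges Nbr H x).Nonempty then
    {((availEdges Nbr H x).exists_min_image (edgeRank H) h).choose}
  else ∅

theorem levelReply_spec (Nbr : L → Finset R) (H : Finset (L × (R × Fin ℓ))) (x : L) :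
    (availEdges Nbr H x = ∅ ∧ levelReply Nbr H x = ∅) ∨
      ∃ e ∈ availEdges Nbr H x, levelReply Nbr H x = {e} ∧
        ∀ e' ∈ availEdges Nbr H x, edgeRank H e ≤ edgeRank H e' := by
  by_cases h : (availEdges Nbr H x).Nonempty
  · right
    have hc := ((availEdges Nbr H x).exists_min_image (edgeRank H) h).choose_spec
    exact ⟨_, hc.1, by simp [levelReply, h], hc.2⟩
  · left
    exact ⟨Finset.not_nonempty_iff_eq_empty.mp h, by simp [levelReply, h]⟩

/-- The request for `x` is not answerable at a level below `i`. -/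
def Reaches (Nbr : L → Finset R) (H : Finset (L × (R × Fin ℓ))) (x : L) (i : ℕ) : Prop :=
  ∀ e ∈ availEdges Nbr H x, i ≤ e.2.2.val

/-- The held edges of level `i`. -/
def levelEdges (H : Finset (L × (R × Fin ℓ))) (i : ℕ) : Finset (L × (R × Fin ℓ)) :=
  H.filter fun e => e.2.2.val = i

open Classical in
theorem LevelInv.step {Nbr : L → Finset R} {H : Finset (L × (R × Fin ℓ))} {A F : Finset L}
    {c i : ℕ} (hi : i < ℓ) (h : LevelInv Nbr (levelEdges H i) A F c) (x : L) :
    LevelInv Nbr (levelEdges (levelReply Nbr H x ∪ H) i)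
      (if Reaches Nbr H x i then insert x A else A)
      (if Reaches Nbr H x (i + 1) then insert x F else F) c := by
  have mono : levelEdges H i ⊆ levelEdges (levelReply Nbr H x ∪ H) i :=
    Finset.filter_subset_filter _ Finset.subset_union_right
  by_cases hF : Reaches Nbr H x (i + 1)
  · -- the request fails at level `i`
    have hA : Reaches Nbr H x i := fun e he => (Nat.le_succ i).trans (hF e he)
    have hO : levelEdges (levelReply Nbr H x ∪ H) i = levelEdges H i := by
      refine (Finset.Subset.antisymm mono fun e he => ?_).symm
      simp only [levelEdges, Finset.mem_filter, Finset.mem_union] at he ⊢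
      refine ⟨he.1.resolve_left fun hr => ?_, he.2⟩
      rcases levelReply_spec Nbr H x with ⟨-, h0⟩ | ⟨e', he', h1, -⟩
      · simp [h0] at hr
      · rw [h1, Finset.mem_singleton] at hr
        have := hF e' he'
        rw [← hr] at this
        omega
    have hnot : ∀ e ∈ levelEdges H i, e.1 ≠ x := by
      intro e he hx
      simp only [levelEdges, Finset.mem_filter] at he
      have := hF e (mem_availEdges.mpr ⟨hx, Or.inl he.1⟩)
      omega
    have hblocked : ∀ y ∈ Nbr x, ∃ e ∈ levelEdges H i, e.2.1 = y := by
      intro y hy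
      by_contra! hcon
      have := hF (x, (y, ⟨i, hi⟩)) (mem_availEdges.mpr ⟨rfl, Or.inr ⟨hy, fun e he hee => by
        refine hcon e ?_ (by rw [hee])
        simp only [levelEdges, Finset.mem_filter]
        exact ⟨he, by rw [hee]⟩⟩⟩)
      simp at this
    rw [if_pos hA, if_pos hF, hO]
    refine ⟨fun z hz => ?_, fun z hz => ?_, ?_⟩
    · rcases Finset.mem_insert.mp hz with rfl | hz
      · exact Or.inl (Finset.mem_insert_self _ _)
      · exact (h.held z hz).imp_left Finset.mem_insert_of_mem
    · rcases Finset.mem_insert.mp hz with rfl | hz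
      · exact hblocked
      · exact h.blocked z hz
    · have := h.card_le
      by_cases hxF : x ∈ F
      · rw [Finset.insert_eq_of_mem hxF]
        exact this.trans (by gcongr; exact Finset.subset_insert _ _)
      · have hxA : x ∉ A := fun hxA => by
          obtain ⟨e, he, hex⟩ := (h.held x hxA).resolve_left hxF
          exact hnot e he hex
        rw [Finset.card_insert_of_notMem hxF, Finset.card_insert_of_notMem hxA]
        omega
  · rw [if_neg hF]
    by_cases hA : Reaches Nbr H x i
    · -- the request is answered at level `i`
      rw [if_pos hA]
      obtain ⟨e₀, he₀, hlt⟩ : ∃ e ∈ availEdges Nbr H x, e.2.2.val = i := by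
        simp only [Reaches] at hF
        push Not at hF
        obtain ⟨e, he, hlt⟩ := hF
        exact ⟨e, he, by have := hA e he; omega⟩
      obtain ⟨e, he, hr, hmin⟩ : ∃ e ∈ availEdges Nbr H x, levelReply Nbr H x = {e} ∧
          ∀ e' ∈ availEdges Nbr H x, edgeRank H e ≤ edgeRank H e' := by
        rcases levelReply_spec Nbr H x with ⟨h0, -⟩ | h1
        · simp [h0] at he₀
        · exact h1
      have hlev : e.2.2.val = i := by
        have h1 := hA e he
        have h2 := hmin e₀ he₀
        simp only [edgeRank] at h2
        split_ifs at h2 <;> omega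
      have hex := (mem_availEdges.mp he).1
      have hmem : e ∈ levelEdges (levelReply Nbr H x ∪ H) i := by
        simp [levelEdges, hr, hlev]
      have hO : levelEdges (levelReply Nbr H x ∪ H) i = insert e (levelEdges H i) := by
        ext e'
        simp only [levelEdges, hr, Finset.mem_filter, Finset.mem_union, Finset.mem_singleton,
          Finset.mem_insert]
        constructor
        · rintro ⟨h1 | h1, h2⟩
          · exact Or.inl h1
          · exact Or.inr ⟨h1, h2⟩
        · rintro (rfl | h1)
          · exact ⟨Or.inl rfl, hlev⟩
          · exact ⟨Or.inr h1.1, h1.2⟩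
      refine ⟨fun z hz => ?_, fun z hz y hy => ?_, ?_⟩
      · rcases Finset.mem_insert.mp hz with rfl | hz
        · exact Or.inr ⟨e, hmem, hex⟩
        · exact (h.held z hz).imp_right fun ⟨e', h1, h2⟩ => ⟨e', mono h1, h2⟩
      · obtain ⟨e', h1, h2⟩ := h.blocked z hz y hy
        exact ⟨e', mono h1, h2⟩
      · have hcard := h.card_le
        rw [hO]
        by_cases heH : e ∈ H
        · rw [Finset.insert_eq_of_mem (by simp [levelEdges, heH, hlev])]
          exact hcard.trans (by gcongr; exact Finset.subset_insert _ _)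
        · have hxA : x ∉ A := fun hxA => by
            have hfree := ((mem_availEdges.mp he).2.resolve_left heH)
            rcases h.held x hxA with hxF | ⟨e', he', hx'⟩
            · obtain ⟨e', he', hy'⟩ := h.blocked x hxF _ hfree.1
              simp only [levelEdges, Finset.mem_filter] at he'
              exact hfree.2 e' he'.1 (Prod.ext hy' (Fin.ext (he'.2.trans hlev.symm)))
            · simp only [levelEdges, Finset.mem_filter] at he'
              have := hmin e' (mem_availEdges.mpr ⟨hx', Or.inl he'.1⟩)
              simp only [edgeRank, if_neg heH, if_pos he'.1] at this
              omega
          have := Finset.card_insert_le e (levelEdges H i)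
          rw [Finset.card_insert_of_notMem hxA]
          omega
    · rw [if_neg hA]
      have hO : levelEdges (levelReply Nbr H x ∪ H) i = levelEdges H i := by
        refine (Finset.Subset.antisymm mono fun e he => ?_).symm
        simp only [levelEdges, Finset.mem_filter, Finset.mem_union] at he ⊢
        refine ⟨he.1.resolve_left fun hr => ?_, he.2⟩
        simp only [Reaches] at hA
        push Not at hA
        obtain ⟨e₀, he₀, hlt⟩ := hA
        rcases levelReply_spec Nbr H x with ⟨-, h0⟩ | ⟨e', -, h1, hmin⟩
        · simp [h0] at hr
        · rw [h1, Finset.mem_singleton] at hr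
          have := hmin e₀ he₀
          rw [← hr] at this
          simp only [edgeRank] at this
          split_ifs at this <;> omega
      rw [hO]
      exact h

/-- The state of a play: the number of rounds played, the current matching, the held edges and
the last reply. -/
structure PlayState (L R : Type) (ℓ : ℕ) where
  /-- The number of rounds played. -/
  round : ℕ
  /-- The current matching. -/
  current : Finset (L × (R × Fin ℓ))
  /-- The held edges. -/
  held : Finset (L × (R × Fin ℓ))
  /-- The reply of the last round. -/
  last : Finset (L × (R × Fin ℓ))

/-- At the rounds divisible by `K * 2 ^ (i + 1)`, the held edges of level `i` that are no longer
in the matching `M` are released. -/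
def release (K n : ℕ) (M H : Finset (L × (R × Fin ℓ))) : Finset (L × (R × Fin ℓ)) :=
  H.filter fun e => K * 2 ^ (e.2.2.val + 1) ∣ n → e ∈ M

/-- One round of play with the level strategy. -/
noncomputable def playStep (Nbr : L → Finset R) (K : ℕ) (s : PlayState L R ℓ)
    (q : ReqMove L (R × Fin ℓ)) : PlayState L R ℓ where
  round := s.round + 1
  current := levelReply Nbr (release K s.round (s.current \ q.1) s.held) q.2 ∪ (s.current \ q.1)
  held := levelReply Nbr (release K s.round (s.current \ q.1) s.held) q.2 ∪
    release K s.round (s.current \ q.1) s.held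
  last := levelReply Nbr (release K s.round (s.current \ q.1) s.held) q.2

/-- The strategy answering each request at the lowest possible level. -/
noncomputable def levelStrategy (Nbr : L → Finset R) (K ℓ : ℕ) : Strategy L (R × Fin ℓ) :=
  fun h => (h.foldl (playStep Nbr K) ⟨0, ∅, ∅, ∅⟩).last

/-- The state before round `n`. -/
noncomputable def stateAt (Nbr : L → Finset R) (K : ℕ) (req : ℕ → ReqMove L (R × Fin ℓ)) :
    ℕ → PlayState L R ℓ
  | 0 => ⟨0, ∅, ∅, ∅⟩
  | n + 1 => playStep Nbr K (stateAt Nbr K req n) (req n)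

theorem foldl_ofFn_playStep (Nbr : L → Finset R) (K : ℕ) (req : ℕ → ReqMove L (R × Fin ℓ))
    (n : ℕ) :
    (List.ofFn fun i : Fin n => req i.1).foldl (playStep Nbr K) ⟨0, ∅, ∅, ∅⟩ =
      stateAt Nbr K req n := by
  induction n with
  | zero => simp [stateAt]
  | succ n ih =>
    rw [List.ofFn_succ', List.concat_eq_append, List.foldl_append]
    simp only [Fin.val_castSucc, Fin.val_last, ih, List.foldl_cons, List.foldl_nil, stateAt]

theorem round_stateAt (Nbr : L → Finset R) (K : ℕ) (req : ℕ → ReqMove L (R × Fin ℓ)) (n : ℕ) :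
    (stateAt Nbr K req n).round = n := by
  induction n with
  | zero => rfl
  | succ n ih => simp [stateAt, playStep, ih]

theorem levelStrategy_histUpTo (Nbr : L → Finset R) (K : ℕ)
    (req : ℕ → ReqMove L (R × Fin ℓ)) (n : ℕ) :
    levelStrategy Nbr K ℓ (histUpTo req n) = (stateAt Nbr K req (n + 1)).last := by
  rw [levelStrategy, histUpTo, foldl_ofFn_playStep]

theorem matchingAfter_levelStrategy (Nbr : L → Finset R) (K : ℕ)
    (req : ℕ → ReqMove L (R × Fin ℓ)) (n : ℕ) :
    matchingAfter (levelStrategy Nbr K ℓ) req n = (stateAt Nbr K req n).current := by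
  induction n with
  | zero => rfl
  | succ n ih =>
    rw [matchingAfter, levelStrategy_histUpTo, ih]
    rfl

/-- The held edges at round `n` after the release and before the reply. -/
noncomputable def heldAt (Nbr : L → Finset R) (K : ℕ) (req : ℕ → ReqMove L (R × Fin ℓ)) (n : ℕ) :
    Finset (L × (R × Fin ℓ)) :=
  release K n ((stateAt Nbr K req n).current \ (req n).1) (stateAt Nbr K req n).held

theorem held_stateAt_succ (Nbr : L → Finset R) (K : ℕ) (req : ℕ → ReqMove L (R × Fin ℓ))
    (n : ℕ) :
    (stateAt Nbr K req (n + 1)).held =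
      levelReply Nbr (heldAt Nbr K req n) (req n).2 ∪ heldAt Nbr K req n := by
  simp only [stateAt, playStep, heldAt, round_stateAt]

theorem last_stateAt_succ (Nbr : L → Finset R) (K : ℕ) (req : ℕ → ReqMove L (R × Fin ℓ))
    (n : ℕ) :
    (stateAt Nbr K req (n + 1)).last = levelReply Nbr (heldAt Nbr K req n) (req n).2 := by
  simp only [stateAt, playStep, heldAt, round_stateAt]

theorem current_stateAt_succ (Nbr : L → Finset R) (K : ℕ) (req : ℕ → ReqMove L (R × Fin ℓ))
    (n : ℕ) :
    (stateAt Nbr K req (n + 1)).current =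
      levelReply Nbr (heldAt Nbr K req n) (req n).2 ∪
        ((stateAt Nbr K req n).current \ (req n).1) := by
  simp only [stateAt, playStep, heldAt, round_stateAt]

theorem current_subset_held (Nbr : L → Finset R) (K : ℕ) (req : ℕ → ReqMove L (R × Fin ℓ))
    (n : ℕ) : (stateAt Nbr K req n).current ⊆ (stateAt Nbr K req n).held := by
  induction n with
  | zero => exact subset_rfl
  | succ n ih =>
    rw [current_stateAt_succ, held_stateAt_succ]
    refine Finset.union_subset_union_right fun e he => ?_
    exact Finset.mem_filter.mpr ⟨ih (Finset.mem_sdiff.mp he).1, fun _ => he⟩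

/-- Held edges are graph edges and occupy distinct right nodes. -/
theorem held_stateAt_valid (Nbr : L → Finset R) (K : ℕ) (req : ℕ → ReqMove L (R × Fin ℓ))
    (n : ℕ) :
    (∀ e ∈ (stateAt Nbr K req n).held, e.2.1 ∈ Nbr e.1) ∧
      ∀ e ∈ (stateAt Nbr K req n).held, ∀ e' ∈ (stateAt Nbr K req n).held,
        e.2 = e'.2 → e = e' := by
  induction n with
  | zero => simp [stateAt]
  | succ n ih =>
    have hsub : heldAt Nbr K req n ⊆ (stateAt Nbr K req n).held := Finset.filter_subset _ _
    rw [held_stateAt_succ]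
    rcases levelReply_spec Nbr (heldAt Nbr K req n) (req n).2 with ⟨-, h0⟩ | ⟨e₀, he₀, h1, -⟩
    · rw [h0, Finset.empty_union]
      exact ⟨fun e he => ih.1 e (hsub he), fun e he e' he' => ih.2 e (hsub he) e' (hsub he')⟩
    · rw [h1]
      obtain ⟨hx, hH | ⟨hy, hfree⟩⟩ := mem_availEdges.mp he₀
      · rw [Finset.union_eq_right.mpr (by simpa using hH)]
        exact ⟨fun e he => ih.1 e (hsub he), fun e he e' he' => ih.2 e (hsub he) e' (hsub he')⟩
      · simp only [Finset.mem_union, Finset.mem_singleton]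
        refine ⟨?_, ?_⟩
        · rintro e (rfl | he)
          · rwa [hx]
          · exact ih.1 e (hsub he)
        · rintro e (rfl | he) e' (rfl | he') hee
          · rfl
          · exact absurd hee.symm (hfree e' he')
          · exact absurd hee (hfree e he)
          · exact ih.2 e (hsub he) e' (hsub he') hee

open Classical in
/-- The left nodes whose requests reach level `i` during the rounds `s, …, n - 1`. -/
noncomputable def reaching (Nbr : L → Finset R) (K : ℕ) (req : ℕ → ReqMove L (R × Fin ℓ))
    (i s n : ℕ) : Finset L :=
  ((Finset.Ico s n).filter fun t => Reaches Nbr (heldAt Nbr K req t) (req t).2 i).image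
    fun t => (req t).2

open Classical in
theorem reaching_succ (Nbr : L → Finset R) (K : ℕ) (req : ℕ → ReqMove L (R × Fin ℓ))
    {i s n : ℕ} (h : s ≤ n) :
    reaching Nbr K req i s (n + 1) =
      if Reaches Nbr (heldAt Nbr K req n) (req n).2 i then
        insert (req n).2 (reaching Nbr K req i s n) else reaching Nbr K req i s n := by
  rw [reaching, ← Finset.insert_Ico_right_eq_Ico_add_one h, Finset.filter_insert]
  split_ifs with hr
  · rw [Finset.image_insert]
    rfl
  · rfl

theorem reaching_self (Nbr : L → Finset R) (K : ℕ) (req : ℕ → ReqMove L (R × Fin ℓ))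
    (i s : ℕ) : reaching Nbr K req i s s = ∅ := by
  simp [reaching]

theorem card_reaching_le (Nbr : L → Finset R) (K : ℕ) (req : ℕ → ReqMove L (R × Fin ℓ))
    (i s n : ℕ) : (reaching Nbr K req i s n).card ≤ n - s := by
  classical
  refine Finset.card_image_le.trans ((Finset.card_filter_le _ _).trans ?_)
  simp

theorem reaching_subset_union (Nbr : L → Finset R) (K : ℕ)
    (req : ℕ → ReqMove L (R × Fin ℓ)) (i s m n : ℕ) :
    reaching Nbr K req i s n ⊆
      reaching Nbr K req i s (min n m) ∪ reaching Nbr K req i m n := by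
  intro x hx
  simp only [reaching, Finset.mem_image, Finset.mem_filter, Finset.mem_Ico, Finset.mem_union]
    at hx ⊢
  obtain ⟨t, ⟨⟨h1, h2⟩, h3⟩, rfl⟩ := hx
  by_cases h : t < m
  · exact Or.inl ⟨t, ⟨⟨h1, lt_min h2 h⟩, h3⟩, rfl⟩
  · exact Or.inr ⟨t, ⟨⟨not_lt.mp h, h2⟩, h3⟩, rfl⟩

/-- The level invariant holds throughout each phase of level `i`. -/
theorem levelInv_reaching (Nbr : L → Finset R) {K : ℕ}
    (req : ℕ → ReqMove L (R × Fin ℓ)) {i s n c : ℕ} (hi : i < ℓ) (hs : K * 2 ^ (i + 1) ∣ s)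
    (hc : (levelEdges (heldAt Nbr K req s) i).card ≤ c)
    (hsn : s ≤ n) (hn : n < s + K * 2 ^ (i + 1)) :
    LevelInv Nbr (levelEdges (stateAt Nbr K req (n + 1)).held i)
      (reaching Nbr K req i s (n + 1)) (reaching Nbr K req (i + 1) s (n + 1)) c := by
  induction n, hsn using Nat.le_induction with
  | base =>
    rw [reaching_succ _ _ _ le_rfl, reaching_succ _ _ _ le_rfl, reaching_self, reaching_self,
      held_stateAt_succ]
    exact (LevelInv.start Nbr hc).step hi _
  | succ n hsn ih =>
    have hle : s ≤ n + 1 := by omega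
    rw [reaching_succ _ _ _ hle, reaching_succ _ _ _ hle, held_stateAt_succ]
    suffices h : LevelInv Nbr (levelEdges (heldAt Nbr K req (n + 1)) i)
        (reaching Nbr K req i s (n + 1)) (reaching Nbr K req (i + 1) s (n + 1)) c from h.step hi _
    have hndvd : ¬ K * 2 ^ (i + 1) ∣ n + 1 := by
      intro hd
      obtain ⟨d, hd⟩ := (Nat.dvd_sub hd hs)
      rcases Nat.eq_zero_or_pos d with rfl | hpos
      · omega
      · have := Nat.le_mul_of_pos_right (K * 2 ^ (i + 1)) hpos
        omega
    have heq : levelEdges (heldAt Nbr K req (n + 1)) i =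
        levelEdges (stateAt Nbr K req (n + 1)).held i := by
      ext e
      simp only [levelEdges, heldAt, release, Finset.mem_filter]
      refine ⟨fun h => ⟨h.1.1, h.2⟩, fun h => ⟨⟨h.1, fun hd => ?_⟩, h.2⟩⟩
      rw [h.2] at hd
      exact absurd hd hndvd
    rw [heq]
    exact ih (by omega)

theorem card_levelEdges_heldAt_le (Nbr : L → Finset R) {K : ℕ}
    (req : ℕ → ReqMove L (R × Fin ℓ)) {i s : ℕ} (hs : K * 2 ^ (i + 1) ∣ s) :
    (levelEdges (heldAt Nbr K req s) i).card ≤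
      ((stateAt Nbr K req s).current \ (req s).1).card := by
  refine Finset.card_le_card fun e he => ?_
  simp only [levelEdges, heldAt, release, Finset.mem_filter] at he
  exact he.1.2 (by rwa [he.2])

/-- In each phase of level `i`, at most `K` left nodes are passed on to level `i + 1`, provided
Requester plays legally. -/
theorem card_reaching_succ_le {Nbr : L → Finset R} {K N : ℕ} (hexp : Expansion Nbr 3 K)
    (req : ℕ → ReqMove L (R × Fin ℓ))
    (hlegal : ∀ t < N, ((stateAt Nbr K req t).current \ (req t).1).card < K)
    (i : ℕ) (hi : i < ℓ) (s n : ℕ) (hs : K * 2 ^ (i + 1) ∣ s)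
    (hn : n ≤ s + K * 2 ^ (i + 1)) (hnN : n ≤ N) :
    (reaching Nbr K req (i + 1) s n).card ≤ K := by
  induction i generalizing s n with
  | zero =>
    rcases le_or_gt n s with h | h
    · exact (card_reaching_le _ _ _ _ _ _).trans (by omega)
    obtain ⟨n, rfl⟩ : ∃ m, n = m + 1 := ⟨n - 1, by omega⟩
    have hinv := levelInv_reaching Nbr req (n := n) hi hs
      ((card_levelEdges_heldAt_le Nbr req hs).trans (hlegal s (by omega)).le)
      (by omega) (by omega)
    refine hinv.card_le_of_card_le_two_mul hexp le_rfl
      ((card_reaching_le _ _ _ _ _ _).trans ?_)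
    simp only [zero_add, pow_one] at hn
    omega
  | succ i ih =>
    rcases le_or_gt n s with h | h
    · exact (card_reaching_le _ _ _ _ _ _).trans (by omega)
    have hp : K * 2 ^ (i + 1 + 1) = K * 2 ^ (i + 1) + K * 2 ^ (i + 1) := by ring
    have hs' : K * 2 ^ (i + 1) ∣ s := (Dvd.intro_left 2 (by rw [hp]; ring)).trans hs
    have hA : (reaching Nbr K req (i + 1) s n).card ≤ 2 * K := by
      refine (Finset.card_le_card (reaching_subset_union Nbr K req (i + 1) s
        (s + K * 2 ^ (i + 1)) n)).trans ((Finset.card_union_le _ _).trans ?_)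
      have h1 := ih (by omega) s (min n (s + K * 2 ^ (i + 1))) hs' (min_le_right _ _)
        ((min_le_left _ _).trans hnN)
      have h2 := ih (by omega) (s + K * 2 ^ (i + 1)) n (hs'.add dvd_rfl) (by omega) hnN
      omega
    obtain ⟨n, rfl⟩ : ∃ m, n = m + 1 := ⟨n - 1, by omega⟩
    exact (levelInv_reaching Nbr req (n := n) hi hs
      ((card_levelEdges_heldAt_le Nbr req hs).trans (hlegal s (by omega)).le)
      (by omega) (by omega)).card_le_of_card_le_two_mul hexp le_rfl hA

/-- From level `j` on, the number of left nodes reaching a level is halved by each level during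
the first `K * 2 ^ j` rounds. -/
theorem card_reaching_add_le {Nbr : L → Finset R} {K N j : ℕ} (hexp : Expansion Nbr 3 K)
    (req : ℕ → ReqMove L (R × Fin ℓ)) (hN : N ≤ K * 2 ^ j)
    (hlegal : ∀ t < N, ((stateAt Nbr K req t).current \ (req t).1).card < K)
    (d : ℕ) (hd : j + d ≤ ℓ) :
    (reaching Nbr K req (j + d) 0 N).card ≤ K / 2 ^ d := by
  induction d with
  | zero =>
    rw [pow_zero, Nat.div_one, add_zero]
    cases j with
    | zero => exact (card_reaching_le _ _ _ _ _ _).trans (by simpa using hN)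
    | succ j =>
      exact card_reaching_succ_le hexp req hlegal j (by omega) 0 N (dvd_zero _) (by omega) le_rfl
  | succ d ih =>
    rcases Nat.eq_zero_or_pos N with rfl | hpos
    · simp [reaching_self]
    obtain ⟨n, rfl⟩ : ∃ m, N = m + 1 := ⟨N - 1, by omega⟩
    have hA := ih (by omega)
    have hle : K * 2 ^ j ≤ K * 2 ^ (j + d + 1) :=
      Nat.mul_le_mul_left _ (Nat.pow_le_pow_right (by norm_num) (by omega))
    have hinv := levelInv_reaching Nbr req (K := K) (i := j + d) (s := 0) (n := n) (c := 0)
      (by omega) (dvd_zero _) (by simp [levelEdges, heldAt, release, stateAt]) (Nat.zero_le _)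
      (by omega)
    have := hinv.two_mul_card_le hexp (hA.trans (Nat.div_le_self _ _))
    rw [pow_succ, ← Nat.div_div_eq_div_mul]
    rw [← add_assoc]
    omega

end LevelStrategy

end DM

/-- Let `K ≥ 1` and `T = K · 2^j` with `j ≥ 0`. If a bipartite graph has
3-expansion up to `K`, then its `(1 + ⌊log₂ T⌋)`-clone has matching with `T` rounds
(up to `K`, with load 1). -/
theorem stmt5 (L R : Type) [Fintype L] [Fintype R] [DecidableEq L] [DecidableEq R]
    (Nbr : L → Finset R) (K T j : ℕ)
    (hK : 1 ≤ K) (hT : T = K * 2 ^ j)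
    (hexp : Expansion Nbr 3 K) :
    RoundMatching (clone (1 + Nat.log 2 T) Nbr) T K 1 := by
  classical
  refine ⟨levelStrategy Nbr K _, fun req n hn hlegal => ?_⟩
  have hlog : 1 + Nat.log 2 T = j + (Nat.log 2 K + 1) := by
    have : Nat.log 2 (K * 2 ^ j) = Nat.log 2 K + j := by
      clear hT hexp
      induction j with
      | zero => simp
      | succ j ih =>
        rw [pow_succ, ← mul_assoc, Nat.log_mul_base (by norm_num) (by positivity), ih, add_assoc]
    rw [hT, this]
    omega
  have hcard := card_reaching_add_le (N := n + 1) hexp req (by omega)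
    (fun t ht => by
      have := hlegal t (by omega)
      rwa [RemLegal, matchingAfter_levelStrategy] at this)
    (Nat.log 2 K + 1) hlog.ge
  rw [Nat.div_eq_of_lt (Nat.lt_pow_succ_log_self (by norm_num) K), Nat.le_zero,
    Finset.card_eq_zero, ← hlog] at hcard
  have hheld := held_stateAt_valid Nbr K req (n + 1)
  rw [ValidReply, levelStrategy_histUpTo, matchingAfter_levelStrategy, last_stateAt_succ]
  refine ⟨?_, fun z => Finset.card_le_one.mpr fun e he e' he' => ?_⟩
  · rcases levelReply_spec Nbr (heldAt Nbr K req n) (req n).2 with ⟨h0, -⟩ | ⟨e, he, h1, -⟩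
    · have : (req n).2 ∈ reaching Nbr K req (1 + Nat.log 2 T) 0 (n + 1) := by
        rw [reaching_succ _ _ _ (Nat.zero_le _), if_pos (by simp [Reaches, h0])]
        exact Finset.mem_insert_self _ _
      simp [hcard] at this
    · have hx := (mem_availEdges.mp he).1
      refine ⟨e.2, ?_, by rw [h1, ← hx]⟩
      have := hheld.1 e (by rw [held_stateAt_succ, h1]; simp)
      rw [hx] at this
      simpa [clone] using this
  · rw [Finset.mem_filter] at he he'
    exact hheld.2 e (current_subset_held Nbr K req _ he.1) e'
      (current_subset_held Nbr K req _ he'.1) (he.2.trans he'.2.symm)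
end
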